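/- arXiv:math-ph/0312049 — 6 statements merged into one kernel-verified Lean document; each statement's English description precedes it below -/
import Mathlib

section
/- Let K be a field, F a coalgebra over K, and (Δ_T, ε_T) the tensor bialgebra structure on T(F). For every natural number n, the subspace T_n(F) = Σ_{k=0}^{n} (range ι)^k of T(F) (where (range ι)^k denotes the k-th power of the submodule range(ι) in T(F), with (range ι)^0 the span of 1) satisfies Δ_T(T_n(F)) ⊆ T_n(F) ⊗ T_n(F); that is, T_n(F) is a subcoalgebra of the bialgebra T(F). -/
open TensorProduct

/-- The coproduct of the tensor bialgebra structure on `T(F)`: the unique algebra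
homomorphism `T(F) → T(F) ⊗ T(F)` extending `(ι ⊗ ι) ∘ Δ`. -/
noncomputable def tensorBialgebraComul (K F : Type) [Field K] [AddCommGroup F] [Module K F]
    [Coalgebra K F] :
    TensorAlgebra K F →ₐ[K] TensorAlgebra K F ⊗[K] TensorAlgebra K F :=
  TensorAlgebra.lift K
    ((TensorProduct.map (TensorAlgebra.ι K) (TensorAlgebra.ι K)) ∘ₗ Coalgebra.comul (R := K))

theorem tensorRange_mono {K A : Type} [Field K] [Ring A] [Algebra K A] {M N : Submodule K A}
    (h : M ≤ N) : LinearMap.range (TensorProduct.map M.subtype M.subtype) ≤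
      LinearMap.range (TensorProduct.map N.subtype N.subtype) := by
  rintro _ ⟨x, rfl⟩
  induction x with
  | zero => simp
  | add x y hx hy => rw [map_add]; exact add_mem hx hy
  | tmul a b => exact ⟨(⟨a, h a.2⟩ : N) ⊗ₜ (⟨b, h b.2⟩ : N), by simp⟩

theorem tensorRange_mul {K A : Type} [Field K] [Ring A] [Algebra K A] {M N : Submodule K A}
    {u v : A ⊗[K] A} (hu : u ∈ LinearMap.range (TensorProduct.map M.subtype M.subtype))
    (hv : v ∈ LinearMap.range (TensorProduct.map N.subtype N.subtype)) :
    u * v ∈ LinearMap.range (TensorProduct.map (M * N).subtype (M * N).subtype) := by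
  obtain ⟨x, rfl⟩ := hu
  obtain ⟨y, rfl⟩ := hv
  induction x with
  | zero => simp
  | add x x' hx hx' => rw [map_add, add_mul]; exact add_mem hx hx'
  | tmul a b =>
    induction y with
    | zero => simp
    | add y y' hy hy' => rw [map_add, mul_add]; exact add_mem hy hy'
    | tmul c d =>
      exact ⟨(⟨a * c, Submodule.mul_mem_mul a.2 c.2⟩ : ↥(M * N)) ⊗ₜ
        (⟨b * d, Submodule.mul_mem_mul b.2 d.2⟩ : ↥(M * N)), by simp⟩

theorem comul_pow_mem (K F : Type) [Field K] [AddCommGroup F] [Module K F] [Coalgebra K F]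
    (k : ℕ) : (LinearMap.range (TensorAlgebra.ι K (M := F))) ^ k ≤
      (LinearMap.range (TensorProduct.map
        ((LinearMap.range (TensorAlgebra.ι K (M := F))) ^ k).subtype
        ((LinearMap.range (TensorAlgebra.ι K (M := F))) ^ k).subtype)).comap
        (tensorBialgebraComul K F).toLinearMap := by
  induction k with
  | zero =>
    rw [pow_zero, Submodule.one_le]
    refine ⟨(⟨1, Submodule.one_le.mp le_rfl⟩ : ↥(1 : Submodule K (TensorAlgebra K F))) ⊗ₜ
      (⟨1, Submodule.one_le.mp le_rfl⟩ : ↥(1 : Submodule K (TensorAlgebra K F))), ?_⟩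
    simp [Algebra.TensorProduct.one_def]
  | succ k ih =>
    rw [pow_succ, Submodule.mul_le]
    rintro a ha _ ⟨f, rfl⟩
    have h1 := ih ha
    simp only [Submodule.mem_comap, AlgHom.toLinearMap_apply, map_mul] at h1 ⊢
    refine tensorRange_mul h1 ?_
    rw [tensorBialgebraComul, TensorAlgebra.lift_ι_apply, LinearMap.comp_apply]
    generalize (Coalgebra.comul (R := K) f) = z
    induction z with
    | zero => simp
    | add x y hx hy => rw [map_add]; exact add_mem hx hy
    | tmul a b =>
      exact ⟨(⟨_, a, rfl⟩ : LinearMap.range (TensorAlgebra.ι K (M := F))) ⊗ₜ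
        (⟨_, b, rfl⟩ : LinearMap.range (TensorAlgebra.ι K (M := F))), by simp⟩

theorem stmt_1 (K F : Type) [Field K] [AddCommGroup F] [Module K F] [Coalgebra K F] (n : ℕ)
    (Tn : Submodule K (TensorAlgebra K F))
    (hTn : Tn = ∑ k ∈ Finset.range (n + 1),
      (LinearMap.range (TensorAlgebra.ι K (M := F))) ^ k) :
    ∀ w ∈ Tn, tensorBialgebraComul K F w ∈
      LinearMap.range (TensorProduct.map Tn.subtype Tn.subtype) := by
  have hle : ∀ k ∈ Finset.range (n + 1),
      (LinearMap.range (TensorAlgebra.ι K (M := F))) ^ k ≤ Tn := by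
    intro k hk
    rw [hTn]
    exact Finset.single_le_sum (f := fun k => (LinearMap.range (TensorAlgebra.ι K (M := F))) ^ k)
      (fun _ _ => bot_le) hk
  have key : (∑ k ∈ Finset.range (n + 1), (LinearMap.range (TensorAlgebra.ι K (M := F))) ^ k) ≤
      (LinearMap.range (TensorProduct.map Tn.subtype Tn.subtype)).comap
        (tensorBialgebraComul K F).toLinearMap := by
    refine Finset.sum_induction _ (fun S => S ≤ _) (fun _ _ ha hb => sup_le ha hb) bot_le ?_
    exact fun k hk x hx => tensorRange_mono (hle k hk) (comul_pow_mem K F k hx)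
  intro w hw
  rw [hTn] at hw
  exact key hw
end

section
/- Let K be a field and F a coalgebra over K with coproduct Δ and counit ε. Let V be a finite-dimensional subspace of the space of right-invariant linear operators on F. Suppose there exists a subspace J ⊆ F of finite codimension such that ε(J) = 0, Δ(J) ⊆ J ⊗ F + F ⊗ J, and (ε ∘ X)(J) = 0 for every X ∈ V. Then the unital subalgebra of End(F) generated by V is finite-dimensional. -/
open TensorProduct

/-- A linear operator `X` on a coalgebra `F` is right-invariant if `Δ ∘ X = (X ⊗ id) ∘ Δ`. -/
def IsRightInvariant (K F : Type) [Field K] [AddCommGroup F] [Module K F] [Coalgebra K F]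
    (X : Module.End K F) : Prop :=
  Coalgebra.comul (R := K) ∘ₗ X = LinearMap.rTensor F X ∘ₗ Coalgebra.comul (R := K)

/-- A right-invariant operator is recovered from its composite with the counit. -/
theorem rightInv_eq {K F : Type} [Field K] [AddCommGroup F] [Module K F] [Coalgebra K F]
    {X : Module.End K F} (hX : IsRightInvariant K F X) :
    X = (TensorProduct.lid K F).toLinearMap ∘ₗ
      LinearMap.rTensor F (Coalgebra.counit (R := K) ∘ₗ X) ∘ₗ Coalgebra.comul (R := K) := by
  ext f
  have h := LinearMap.congr_fun hX f
  have h2 := Coalgebra.rTensor_counit_comul (R := K) (X f)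
  simp only [LinearMap.comp_apply] at h
  rw [h] at h2
  simp only [LinearMap.comp_apply, LinearMap.rTensor_comp, LinearEquiv.coe_coe]
  rw [h2]
  simp

/-- The right-invariant operators whose composite with the counit vanishes on `J`. -/
def invSubalgebra (K F : Type) [Field K] [AddCommGroup F] [Module K F] [Coalgebra K F]
    (J : Submodule K F)
    (hJε : ∀ f ∈ J, Coalgebra.counit (R := K) f = 0)
    (hJΔ : ∀ f ∈ J, Coalgebra.comul (R := K) f ∈
      LinearMap.range (TensorProduct.map J.subtype (LinearMap.id : F →ₗ[K] F)) ⊔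
      LinearMap.range (TensorProduct.map (LinearMap.id : F →ₗ[K] F) J.subtype)) :
    Subalgebra K (Module.End K F) where
  carrier := {X | IsRightInvariant K F X ∧ ∀ f ∈ J, Coalgebra.counit (R := K) (X f) = 0}
  mul_mem' := by
    rintro X Y ⟨hX, hXJ⟩ ⟨hY, hYJ⟩
    refine ⟨?_, ?_⟩
    · unfold IsRightInvariant at *
      rw [Module.End.mul_eq_comp, ← LinearMap.comp_assoc, hX, LinearMap.comp_assoc, hY,
        ← LinearMap.comp_assoc, ← LinearMap.rTensor_comp]
    · intro f hf
      let g : F ⊗[K] F →ₗ[K] K := (Coalgebra.counit (R := K) ∘ₗ X) ∘ₗ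
        (TensorProduct.lid K F).toLinearMap ∘ₗ
          LinearMap.rTensor F (Coalgebra.counit (R := K) ∘ₗ Y)
      have hg : Coalgebra.counit (R := K) ((X * Y) f) = g (Coalgebra.comul (R := K) f) := by
        have := LinearMap.congr_fun (rightInv_eq hY) f
        rw [Module.End.mul_apply, this]
        rfl
      rw [hg]
      have hle : LinearMap.range (TensorProduct.map J.subtype (LinearMap.id : F →ₗ[K] F)) ⊔
          LinearMap.range (TensorProduct.map (LinearMap.id : F →ₗ[K] F) J.subtype)
          ≤ LinearMap.ker g := by
        refine sup_le ?_ ?_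
        · rw [LinearMap.range_le_ker_iff]
          ext a b
          simp [g, hYJ a a.2]
        · rw [LinearMap.range_le_ker_iff]
          ext a b
          simp [g, hXJ b b.2]
      exact hle (hJΔ f hf)
  add_mem' := by
    rintro X Y ⟨hX, hXJ⟩ ⟨hY, hYJ⟩
    refine ⟨?_, fun f hf => by simp [hXJ f hf, hYJ f hf]⟩
    unfold IsRightInvariant at *
    rw [LinearMap.comp_add, LinearMap.rTensor_add, LinearMap.add_comp, hX, hY]
  algebraMap_mem' := by
    intro r
    refine ⟨?_, fun f hf => by simp [Module.algebraMap_end_apply, hJε f hf]⟩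
    unfold IsRightInvariant
    rw [Algebra.algebraMap_eq_smul_one, LinearMap.rTensor_smul, LinearMap.comp_smul,
      LinearMap.smul_comp, Module.End.one_eq_id, LinearMap.rTensor_id]
    rfl

theorem stmt_7 (K F : Type) [Field K] [AddCommGroup F] [Module K F] [Coalgebra K F]
    (V : Submodule K (Module.End K F)) [FiniteDimensional K V]
    (hV : ∀ X ∈ V, IsRightInvariant K F X)
    (J : Submodule K F) (hJcodim : FiniteDimensional K (F ⧸ J))
    (hJε : ∀ f ∈ J, Coalgebra.counit (R := K) f = 0)
    (hJΔ : ∀ f ∈ J, Coalgebra.comul (R := K) f ∈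
      LinearMap.range (TensorProduct.map J.subtype (LinearMap.id : F →ₗ[K] F)) ⊔
      LinearMap.range (TensorProduct.map (LinearMap.id : F →ₗ[K] F) J.subtype))
    (hJV : ∀ X ∈ V, ∀ f ∈ J, Coalgebra.counit (R := K) (X f) = 0) :
    FiniteDimensional K (Algebra.adjoin K (V : Set (Module.End K F))) := by
  have hle : Algebra.adjoin K (V : Set (Module.End K F)) ≤ invSubalgebra K F J hJε hJΔ :=
    Algebra.adjoin_le fun X hX => ⟨hV X hX, hJV X hX⟩
  let T : Algebra.adjoin K (V : Set (Module.End K F)) →ₗ[K] J.dualAnnihilator :=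
    { toFun := fun X => ⟨Coalgebra.counit (R := K) ∘ₗ (X : Module.End K F), by
        rw [Submodule.mem_dualAnnihilator]
        exact (hle X.2).2⟩
      map_add' := fun X Y => by
        ext f
        simp
      map_smul' := fun c X => by
        ext f
        simp }
  let b := Module.finBasis K (Module.Dual K (F ⧸ J))
  let e := J.dualQuotEquivDualAnnihilator.symm.trans b.equivFun
  refine Module.Finite.of_injective (e.toLinearMap ∘ₗ T) ?_
  refine e.injective.comp (g := e) (f := T) ?_
  intro X Y hXY
  have h : Coalgebra.counit (R := K) ∘ₗ (X : Module.End K F) =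
      Coalgebra.counit (R := K) ∘ₗ (Y : Module.End K F) := congrArg Subtype.val hXY
  apply Subtype.ext
  rw [rightInv_eq (hle X.2).1, h, ← rightInv_eq (hle Y.2).1]
end

section
/- Let K be a field, V a K-vector space, B an associative unital K-algebra, L a coalgebra over K with coproduct Δ_L and counit ε_L, and x : L → Hom(V, B) a linear map. Then there exists a unique linear map X : L → Hom(T(V), B), where T(V) is the tensor algebra of V with inclusion ι : V → T(V), such that: (1) X(l)(1) = ε_L(l)·1_B for all l ∈ L; (2) X(l)(ι(v)) = x(l)(v) for all l ∈ L, v ∈ V; (3) for all l ∈ L and all w₁, w₂ ∈ T(V), X(l)(w₁·w₂) = Σₖ X(l'ₖ)(w₁)·X(l''ₖ)(w₂), where Δ_L(l) = Σₖ l'ₖ ⊗ l''ₖ. -/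
open TensorProduct

theorem stmt_9 (K V B L : Type) [Field K] [AddCommGroup V] [Module K V]
    [Ring B] [Algebra K B] [AddCommGroup L] [Module K L] [Coalgebra K L]
    (x : L →ₗ[K] (V →ₗ[K] B)) :
    ∃! X : L →ₗ[K] (TensorAlgebra K V →ₗ[K] B),
      (∀ l : L, X l (1 : TensorAlgebra K V) = Coalgebra.counit (R := K) l • (1 : B)) ∧
      (∀ (l : L) (v : V), X l (TensorAlgebra.ι K v) = x l v) ∧
      (∀ (l : L) (w₁ w₂ : TensorAlgebra K V), X l (w₁ * w₂) =
        LinearMap.mul' K B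
          (TensorProduct.map ((LinearMap.applyₗ w₁) ∘ₗ X) ((LinearMap.applyₗ w₂) ∘ₗ X)
            (Coalgebra.comul (R := K) l))) := by
  let f : V →ₗ[K] WithConv (L →ₗ[K] B) :=
    { toFun := fun v => WithConv.toConv (x.flip v)
      map_add' := fun a b => by rw [map_add]; rfl
      map_smul' := fun a b => by rw [map_smul]; rfl }
  let F : TensorAlgebra K V →ₐ[K] WithConv (L →ₗ[K] B) := TensorAlgebra.lift K f
  let G : TensorAlgebra K V →ₗ[K] (L →ₗ[K] B) :=
    { toFun := fun w => (F w).ofConv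
      map_add' := fun a b => by rw [map_add]; rfl
      map_smul' := fun a b => by rw [map_smul]; rfl }
  have hG : ∀ w, G.flip.flip w = (F w).ofConv := fun w => rfl
  have happ : ∀ w, (LinearMap.applyₗ w) ∘ₗ G.flip = (F w).ofConv := fun w => rfl
  refine ⟨G.flip, ⟨?_, ?_, ?_⟩, ?_⟩
  · intro l
    change (F 1).ofConv l = _
    rw [map_one]
    exact (LinearMap.convOne_apply l).trans (Algebra.algebraMap_eq_smul_one _)
  · intro l v
    change (F (TensorAlgebra.ι K v)).ofConv l = _
    rw [TensorAlgebra.lift_ι_apply]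
    rfl
  · intro l w₁ w₂
    rw [happ, happ]
    change (F (w₁ * w₂)).ofConv l = _
    rw [map_mul]
    rfl
  · rintro Y ⟨h1, h2, h3⟩
    have key : ∀ w, Y.flip w = (F w).ofConv := by
      intro w
      induction w using TensorAlgebra.induction with
      | algebraMap r =>
        ext l
        rw [AlgHom.commutes, Algebra.algebraMap_eq_smul_one, map_smul]
        rw [LinearMap.smul_apply, LinearMap.flip_apply, h1, Algebra.algebraMap_eq_smul_one,
          ← Algebra.algebraMap_eq_smul_one (Coalgebra.counit (R := K) l)]
        exact congrArg (r • ·) (LinearMap.convOne_apply l).symm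
      | ι v =>
        ext l
        rw [TensorAlgebra.lift_ι_apply]
        exact h2 l v
      | mul a b ha hb =>
        ext l
        rw [map_mul F]
        refine (h3 l a b).trans ?_
        have ea : (LinearMap.applyₗ a) ∘ₗ Y = (F a).ofConv := ha
        have eb : (LinearMap.applyₗ b) ∘ₗ Y = (F b).ofConv := hb
        rw [ea, eb]
        rfl
      | add a b ha hb =>
        rw [map_add, map_add, ha, hb]
        rfl
    ext1 l
    ext1 w
    exact LinearMap.congr_fun (key w) l
end

section
/- Let K be a field, L and F coalgebras over K, and let (Δ_T, ε_T) be the tensor bialgebra structure on T(F). Let x : L → End(F) be a linear map such that each x(l) is a right-invariant operator on F, and let X : L → End(T(F)) be the unique linear map satisfying X(l)(1) = ε_L(l)·1, X(l)(ι(f)) = ι(x(l)(f)) for all f ∈ F, and X(l)(w₁·w₂) = Σₖ X(l'ₖ)(w₁)·X(l''ₖ)(w₂) for all w₁, w₂ ∈ T(F), where Δ_L(l) = Σₖ l'ₖ ⊗ l''ₖ. Then for every l ∈ L, the operator X(l) is right-invariant on the bialgebra T(F): Δ_T ∘ X(l) = (X(l) ⊗ id) ∘ Δ_T. -/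
open TensorProduct

theorem stmt_10 (K L F : Type) [Field K]
    [AddCommGroup L] [Module K L] [Coalgebra K L]
    [AddCommGroup F] [Module K F] [Coalgebra K F]
    (x : L →ₗ[K] Module.End K F)
    (hx : ∀ l : L, Coalgebra.comul (R := K) ∘ₗ x l =
      LinearMap.rTensor F (x l) ∘ₗ Coalgebra.comul (R := K))
    (X : L →ₗ[K] Module.End K (TensorAlgebra K F))
    (hX1 : ∀ l : L, X l (1 : TensorAlgebra K F) =
      Coalgebra.counit (R := K) l • (1 : TensorAlgebra K F))
    (hX2 : ∀ (l : L) (f : F), X l (TensorAlgebra.ι K f) = TensorAlgebra.ι K (x l f))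
    (hX3 : ∀ (l : L) (w₁ w₂ : TensorAlgebra K F), X l (w₁ * w₂) =
      LinearMap.mul' K (TensorAlgebra K F)
        (TensorProduct.map ((LinearMap.applyₗ w₁) ∘ₗ X) ((LinearMap.applyₗ w₂) ∘ₗ X)
          (Coalgebra.comul (R := K) l))) :
    ∀ l : L, (tensorBialgebraComul K F).toLinearMap ∘ₗ X l =
      LinearMap.rTensor (TensorAlgebra K F) (X l) ∘ₗ (tensorBialgebraComul K F).toLinearMap := by
  classical
  have key : ∀ l : L, ∃ S : Finset (L × L), Coalgebra.comul (R := K) l = ∑ p ∈ S, p.1 ⊗ₜ[K] p.2 :=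
    fun l => TensorProduct.exists_finset _
  have hmul : ∀ (l : L) (S : Finset (L × L)),
      Coalgebra.comul (R := K) l = ∑ p ∈ S, p.1 ⊗ₜ[K] p.2 →
      ∀ w₁ w₂ : TensorAlgebra K F, X l (w₁ * w₂) = ∑ p ∈ S, X p.1 w₁ * X p.2 w₂ := by
    intro l S hS w₁ w₂
    rw [hX3, hS]
    simp
  have hmul2 : ∀ (l : L) (S : Finset (L × L)),
      Coalgebra.comul (R := K) l = ∑ p ∈ S, p.1 ⊗ₜ[K] p.2 →
      ∀ u v : TensorAlgebra K F ⊗[K] TensorAlgebra K F,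
        LinearMap.rTensor (TensorAlgebra K F) (X l) (u * v) =
        ∑ p ∈ S, LinearMap.rTensor (TensorAlgebra K F) (X p.1) u *
          LinearMap.rTensor (TensorAlgebra K F) (X p.2) v := by
    intro l S hS u v
    induction u using TensorProduct.induction_on with
    | zero => simp
    | add a b ha hb => rw [add_mul, map_add, ha, hb]; simp [add_mul, Finset.sum_add_distrib]
    | tmul a b =>
      induction v using TensorProduct.induction_on with
      | zero => simp
      | add c d hc hd => rw [mul_add, map_add, hc, hd]; simp [mul_add, Finset.sum_add_distrib]
      | tmul c d =>
        simp only [Algebra.TensorProduct.tmul_mul_tmul, LinearMap.rTensor_tmul]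
        rw [hmul l S hS, TensorProduct.sum_tmul]
  have main : ∀ (w : TensorAlgebra K F) (l : L), tensorBialgebraComul K F (X l w) =
      LinearMap.rTensor (TensorAlgebra K F) (X l) (tensorBialgebraComul K F w) := by
    intro w
    induction w using TensorAlgebra.induction with
    | algebraMap r =>
      intro l
      rw [Algebra.algebraMap_eq_smul_one]
      simp only [map_smul, hX1, map_one, Algebra.TensorProduct.one_def, LinearMap.rTensor_tmul,
        TensorProduct.smul_tmul']
    | ι f =>
      intro l
      have h := LinearMap.congr_fun (hx l) f
      simp only [LinearMap.comp_apply] at h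
      rw [hX2]
      simp only [tensorBialgebraComul, TensorAlgebra.lift_ι_apply, LinearMap.comp_apply, h]
      generalize (Coalgebra.comul (R := K) f : F ⊗[K] F) = t
      induction t using TensorProduct.induction_on with
      | zero => simp
      | add a b ha hb => simp only [map_add, ha, hb]
      | tmul a b => simp [hX2]
    | mul a b ha hb =>
      intro l
      obtain ⟨S, hS⟩ := key l
      rw [hmul l S hS, map_mul, hmul2 l S hS, map_sum]
      refine Finset.sum_congr rfl fun p _ => ?_
      rw [map_mul, ha, hb]
    | add a b ha hb =>
      intro l
      simp only [map_add, ha, hb]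
  intro l
  ext1 w
  exact main w l
end

section
/- Let K be a field, L and F coalgebras over K, (Δ_T, ε_T) the tensor bialgebra structure on T(F), x : L → End(F) a linear map with each x(l) right-invariant on F, and X : L → End(T(F)) the unique linear map satisfying X(l)(1) = ε_L(l)·1, X(l)(ι(f)) = ι(x(l)(f)), and X(l)(w₁·w₂) = Σₖ X(l'ₖ)(w₁)·X(l''ₖ)(w₂) where Δ_L(l) = Σₖ l'ₖ ⊗ l''ₖ. Let U be the unital subalgebra of End(T(F)) generated by {X(l) : l ∈ L}. Then there exists a unique pair of K-algebra homomorphisms Δ_U : U → U ⊗ U and ε_U : U → K such that Δ_U(X(l)) = Σₖ X(l'ₖ) ⊗ X(l''ₖ) and ε_U(X(l)) = ε_L(l) for all l ∈ L; moreover Δ_U is coassociative and ε_U is a counit for Δ_U, so that (U, Δ_U, ε_U) is a bialgebra. -/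
open TensorProduct
set_option synthInstance.maxHeartbeats 1000000
set_option maxHeartbeats 2000000

theorem aux_inj {K V W M N : Type} [Field K] [AddCommGroup V] [Module K V] [AddCommGroup W]
    [Module K W] [AddCommGroup M] [Module K M] [AddCommGroup N] [Module K N]
    (j : V →ₗ[K] M →ₗ[K] K) (k : W →ₗ[K] N →ₗ[K] K)
    (hj : Function.Injective j) (hk : Function.Injective k) (t : V ⊗[K] W)
    (ht : ∀ m n, LinearMap.mul' K K (TensorProduct.map (LinearMap.applyₗ m ∘ₗ j)
      (LinearMap.applyₗ n ∘ₗ k) t) = 0) : t = 0 := by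
  classical
  let b := Module.Basis.ofVectorSpace K W
  obtain ⟨f, rfl⟩ := (TensorProduct.equivFinsuppOfBasisRight (M := V) b).symm.surjective t
  rw [TensorProduct.equivFinsuppOfBasisRight_symm_apply] at ht ⊢
  have h1 : ∀ m i, j (f i) m = 0 := by
    intro m i
    by_cases hi : i ∈ f.support
    · have h2 : ∑ i ∈ f.support, j (f i) m • b i = 0 := by
        apply hk
        ext n
        have := ht m n
        simpa [Finsupp.sum] using this
      exact linearIndependent_iff'.1 b.linearIndependent _ _ h2 i hi
    · simp [Finsupp.notMem_support_iff.1 hi]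
  have h3 : f = 0 := by
    ext i
    apply hj
    ext m
    simpa using h1 m i
  simp [h3]

theorem aux_ker {K V W : Type} [Field K] [AddCommMonoid V] [Module K V] [AddCommMonoid W]
    [Module K W] (f : V →ₗ[K] W) (h : ∀ t, f t = 0 → t = 0) : Function.Injective f := by
  have hc : ∀ {M : Type} [AddCommMonoid M] [Module K M] (m : M), m + (-1 : K) • m = 0 := by
    intro M _ _ m
    have := add_smul (1 : K) (-1) m
    simpa using this.symm
  intro a b hab
  have h1 : a + (-1 : K) • b = 0 := h _ (by rw [map_add, map_smul, hab, hc])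
  calc a = a + (b + (-1 : K) • b) := by rw [hc, add_zero]
    _ = (a + (-1 : K) • b) + b := by rw [add_comm b, add_assoc]
    _ = b := by rw [h1, zero_add]

theorem aux_rinv {K L F : Type} [Field K]
    [AddCommGroup L] [Module K L] [Coalgebra K L]
    [AddCommGroup F] [Module K F] [Coalgebra K F]
    (x : L →ₗ[K] Module.End K F)
    (hx : ∀ l : L, Coalgebra.comul (R := K) ∘ₗ x l =
      LinearMap.rTensor F (x l) ∘ₗ Coalgebra.comul (R := K))
    (X : L →ₗ[K] Module.End K (TensorAlgebra K F))
    (hX1 : ∀ l : L, X l (1 : TensorAlgebra K F) =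
      Coalgebra.counit (R := K) l • (1 : TensorAlgebra K F))
    (hX2 : ∀ (l : L) (f : F), X l (TensorAlgebra.ι K f) = TensorAlgebra.ι K (x l f))
    (hX3 : ∀ (l : L) (w₁ w₂ : TensorAlgebra K F), X l (w₁ * w₂) =
      LinearMap.mul' K (TensorAlgebra K F)
        (TensorProduct.map ((LinearMap.applyₗ w₁) ∘ₗ X) ((LinearMap.applyₗ w₂) ∘ₗ X)
          (Coalgebra.comul (R := K) l)))
    (D : TensorAlgebra K F →ₐ[K] TensorAlgebra K F ⊗[K] TensorAlgebra K F)
    (hD : ∀ f, D (TensorAlgebra.ι K f) = TensorProduct.map (TensorAlgebra.ι K)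
      (TensorAlgebra.ι K) (Coalgebra.comul (R := K) f))
    (w : TensorAlgebra K F) :
    ∀ l, D (X l w) = LinearMap.rTensor (TensorAlgebra K F) (X l) (D w) := by
  induction w using TensorAlgebra.induction with
  | algebraMap r =>
    intro l
    simp [Algebra.algebraMap_eq_smul_one, hX1, Algebra.TensorProduct.one_def, TensorProduct.smul_tmul']
  | ι f =>
    intro l
    have h := congrArg (TensorProduct.map (TensorAlgebra.ι K) (TensorAlgebra.ι K))
      (LinearMap.congr_fun (hx l) f)
    rw [hX2, hD, hD]
    refine h.trans ?_
    simp only [LinearMap.comp_apply]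
    generalize (Coalgebra.comul (R := K) f) = c
    induction c with
    | zero => simp
    | tmul a b => simp [hX2]
    | add a b ha hb => simp only [map_add, ha, hb]
  | add a b ha hb => intro l; simp only [map_add, ha, hb]
  | mul a b ha hb =>
    intro l
    have key : ∀ s t : TensorAlgebra K F ⊗[K] TensorAlgebra K F,
        LinearMap.rTensor (TensorAlgebra K F) (X l) (s * t) =
        ∑ i ∈ (Coalgebra.Repr.arbitrary K l).index,
          LinearMap.rTensor (TensorAlgebra K F) (X ((Coalgebra.Repr.arbitrary K l).left i)) s *
          LinearMap.rTensor (TensorAlgebra K F) (X ((Coalgebra.Repr.arbitrary K l).right i)) t := by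
      intro s t
      induction s with
      | zero => simp
      | add a b ha hb => simp only [add_mul, map_add, ha, hb, Finset.sum_add_distrib]
      | tmul a b =>
        induction t with
        | zero => simp
        | add a b ha hb => simp only [mul_add, map_add, ha, hb, Finset.sum_add_distrib]
        | tmul c d =>
          simp only [Algebra.TensorProduct.tmul_mul_tmul, LinearMap.rTensor_tmul, hX3,
            ← (Coalgebra.Repr.arbitrary K l).eq]
          simp [TensorProduct.sum_tmul]
    rw [map_mul D, key, hX3, ← (Coalgebra.Repr.arbitrary K l).eq]
    simp [ha, hb]

theorem aux_sep {K F : Type} [Field K]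
    [AddCommGroup F] [Module K F] [Coalgebra K F]
    (D : TensorAlgebra K F →ₐ[K] TensorAlgebra K F ⊗[K] TensorAlgebra K F)
    (hD : ∀ f, D (TensorAlgebra.ι K f) = TensorProduct.map (TensorAlgebra.ι K)
      (TensorAlgebra.ι K) (Coalgebra.comul (R := K) f))
    (E : TensorAlgebra K F →ₐ[K] K)
    (hE : ∀ f, E (TensorAlgebra.ι K f) = Coalgebra.counit (R := K) f)
    (u : Module.End K (TensorAlgebra K F))
    (hu : ∀ w, D (u w) = LinearMap.rTensor (TensorAlgebra K F) u (D w))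
    (h0 : ∀ w, E (u w) = 0) : u = 0 := by
  have hc : ((Algebra.TensorProduct.lid K (TensorAlgebra K F)).toAlgHom.comp
      (Algebra.TensorProduct.map E (AlgHom.id K _))).comp D = AlgHom.id K _ := by
    apply TensorAlgebra.hom_ext
    ext f
    have h := congrArg (fun z => TensorAlgebra.ι K (TensorProduct.lid K F z))
      (Coalgebra.rTensor_counit_comul (R := K) f)
    simp only [TensorProduct.lid_tmul, one_smul] at h
    simp only [LinearMap.comp_apply, AlgHom.toLinearMap_apply, AlgHom.comp_apply, hD,
      AlgHom.id_apply]
    refine Eq.trans ?_ h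
    generalize (Coalgebra.comul (R := K) f) = c
    induction c with
    | zero => simp
    | tmul a b => simp [hE]
    | add a b ha hb => simp only [map_add, ha, hb]
  ext w
  have h1 := AlgHom.congr_fun hc (u w)
  simp only [AlgHom.comp_apply, AlgHom.id_apply, hu] at h1
  rw [← h1, LinearMap.zero_apply]
  generalize D w = c
  induction c with
  | zero => simp
  | tmul a b => simp [h0]
  | add a b ha hb => simp only [map_add, ha, hb, add_zero]

theorem stmt_12 (K L F : Type) [Field K]
    [AddCommGroup L] [Module K L] [Coalgebra K L]
    [AddCommGroup F] [Module K F] [Coalgebra K F]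
    (x : L →ₗ[K] Module.End K F)
    (hx : ∀ l : L, Coalgebra.comul (R := K) ∘ₗ x l =
      LinearMap.rTensor F (x l) ∘ₗ Coalgebra.comul (R := K))
    (X : L →ₗ[K] Module.End K (TensorAlgebra K F))
    (hX1 : ∀ l : L, X l (1 : TensorAlgebra K F) =
      Coalgebra.counit (R := K) l • (1 : TensorAlgebra K F))
    (hX2 : ∀ (l : L) (f : F), X l (TensorAlgebra.ι K f) = TensorAlgebra.ι K (x l f))
    (hX3 : ∀ (l : L) (w₁ w₂ : TensorAlgebra K F), X l (w₁ * w₂) =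
      LinearMap.mul' K (TensorAlgebra K F)
        (TensorProduct.map ((LinearMap.applyₗ w₁) ∘ₗ X) ((LinearMap.applyₗ w₂) ∘ₗ X)
          (Coalgebra.comul (R := K) l)))
    (U : Subalgebra K (Module.End K (TensorAlgebra K F)))
    (hU : U = Algebra.adjoin K (Set.range fun l : L => X l))
    (XU : L →ₗ[K] U)
    (hXU : ∀ l : L, (XU l : Module.End K (TensorAlgebra K F)) = X l) :
    (∃! p : (U →ₐ[K] U ⊗[K] U) × (U →ₐ[K] K),
      (∀ l : L, p.1 (XU l) = TensorProduct.map XU XU (Coalgebra.comul (R := K) l)) ∧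
      (∀ l : L, p.2 (XU l) = Coalgebra.counit (R := K) l)) ∧
    (∀ p : (U →ₐ[K] U ⊗[K] U) × (U →ₐ[K] K),
      ((∀ l : L, p.1 (XU l) = TensorProduct.map XU XU (Coalgebra.comul (R := K) l)) ∧
       (∀ l : L, p.2 (XU l) = Coalgebra.counit (R := K) l)) →
      ((TensorProduct.assoc K U U U).toLinearMap ∘ₗ
          LinearMap.rTensor U p.1.toLinearMap ∘ₗ p.1.toLinearMap =
        LinearMap.lTensor U p.1.toLinearMap ∘ₗ p.1.toLinearMap) ∧
      ((TensorProduct.lid K U).toLinearMap ∘ₗ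
          LinearMap.rTensor U p.2.toLinearMap ∘ₗ p.1.toLinearMap = LinearMap.id) ∧
      ((TensorProduct.rid K U).toLinearMap ∘ₗ
          LinearMap.lTensor U p.2.toLinearMap ∘ₗ p.1.toLinearMap = LinearMap.id)) := by
  classical
  let T := TensorAlgebra K F
  let D : T →ₐ[K] T ⊗[K] T := TensorAlgebra.lift K
    (TensorProduct.map (TensorAlgebra.ι K) (TensorAlgebra.ι K) ∘ₗ Coalgebra.comul (R := K))
  have hD : ∀ f, D (TensorAlgebra.ι K f) = TensorProduct.map (TensorAlgebra.ι K)
      (TensorAlgebra.ι K) (Coalgebra.comul (R := K) f) := by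
    intro f
    exact TensorAlgebra.lift_ι_apply _ _
  let E : T →ₐ[K] K := TensorAlgebra.lift K (Coalgebra.counit (R := K))
  have hE : ∀ f, E (TensorAlgebra.ι K f) = Coalgebra.counit (R := K) f := by
    intro f
    exact TensorAlgebra.lift_ι_apply _ _
  clear_value D E
  -- generation
  have hgen : Algebra.adjoin K (Set.range XU) = ⊤ := by
    apply Subalgebra.map_injective (f := U.val) Subtype.val_injective
    rw [AlgHom.map_adjoin, ← Set.range_comp, Algebra.map_top, Subalgebra.range_val]
    refine Eq.trans ?_ hU.symm
    congr 2
    ext1 l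
    exact hXU l
  have ind : ∀ (P : U → Prop), (∀ l, P (XU l)) → (∀ r, P (algebraMap K U r)) →
      (∀ a b, P a → P b → P (a + b)) → (∀ a b, P a → P b → P (a * b)) → ∀ u, P u := by
    intro P h1 h2 h3 h4 u
    have hu : u ∈ Algebra.adjoin K (Set.range XU) := by rw [hgen]; trivial
    induction hu using Algebra.adjoin_induction with
    | mem x hx => obtain ⟨l, rfl⟩ := hx; exact h1 l
    | algebraMap r => exact h2 r
    | add a b _ _ ha hb => exact h3 a b ha hb
    | mul a b _ _ ha hb => exact h4 a b ha hb
  have hinv : ∀ u : U, ∀ w, D (u.1 w) = LinearMap.rTensor T u.1 (D w) := by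
    apply ind
    · intro l w
      rw [hXU]
      exact aux_rinv x hx X hX1 hX2 hX3 D hD w l
    · intro r w
      simp [Algebra.algebraMap_eq_smul_one, LinearMap.rTensor_smul, Module.End.one_eq_id]
    · intro a b ha hb w
      simp [LinearMap.rTensor_add, ha, hb]
    · intro a b ha hb w
      simp [Module.End.mul_eq_comp, LinearMap.rTensor_comp, ha, hb]
  let j : U →ₗ[K] T →ₗ[K] K :=
    (LinearMap.llcomp K T T K E.toLinearMap) ∘ₗ U.val.toLinearMap
  have hj : Function.Injective j := by
    rw [injective_iff_map_eq_zero]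
    intro u hu
    apply Subtype.ext
    exact aux_sep D hD E hE u.1 (hinv u) (fun w => LinearMap.congr_fun hu w)
  let ρ : U ⊗[K] U →ₐ[K] Module.End K (T ⊗[K] T) :=
    (Module.endTensorEndAlgHom (R := K) (S := K) (A := K) (M := T) (N := T)).comp
      (Algebra.TensorProduct.map U.val U.val)
  have hρ : ∀ (a b : U) (w₁ w₂ : T), ρ (a ⊗ₜ b) (w₁ ⊗ₜ w₂) = (a.1 w₁) ⊗ₜ (b.1 w₂) := by
    intro a b w₁ w₂
    rfl
  clear_value ρ
  have hρinj : ∀ t, (LinearMap.mul' K T) ∘ₗ (ρ t) = 0 → t = 0 := by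
    intro t ht
    apply aux_inj (K := K) (V := U) (W := U) (M := TensorAlgebra K F) (N := TensorAlgebra K F) j j hj hj t
    intro m n
    have h := congrArg E (LinearMap.congr_fun ht (m ⊗ₜ n))
    simp only [LinearMap.comp_apply, LinearMap.zero_apply, map_zero] at h
    refine Eq.trans ?_ h
    clear h ht
    induction t with
    | zero => simp
    | add a b ha hb => simp only [map_add, ha, hb, LinearMap.add_apply]
    | tmul a b =>
      simp only [TensorProduct.map_tmul, LinearMap.mul'_apply, hρ, map_mul]
      rfl
  let A : Subalgebra K (U × (U ⊗[K] U)) :=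
    { carrier := {p | (LinearMap.mul' K T) ∘ₗ (ρ p.2) = p.1.1 ∘ₗ LinearMap.mul' K T}
      mul_mem' := by
        intro p q hp hq
        simp only [Set.mem_ofPred_eq] at hp hq ⊢
        rw [Prod.snd_mul, Prod.fst_mul, map_mul, Module.End.mul_eq_comp, ← LinearMap.comp_assoc, hp,
          LinearMap.comp_assoc, hq]
        rfl
      add_mem' := by
        intro p q hp hq
        simp only [Set.mem_ofPred_eq] at hp hq ⊢
        rw [Prod.snd_add, Prod.fst_add, map_add, LinearMap.comp_add, hp, hq]
        rfl
      algebraMap_mem' := by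
        intro r
        simp only [Set.mem_ofPred_eq, Prod.algebraMap_apply, AlgHom.commutes]
        ext1
        ext
        simp [Algebra.algebraMap_eq_smul_one] }
  have hA : ∀ p, p ∈ A ↔ (LinearMap.mul' K T) ∘ₗ (ρ p.2) = p.1.1 ∘ₗ LinearMap.mul' K T :=
    fun p => Iff.rfl
  have hXA : ∀ l, (XU l, TensorProduct.map XU XU (Coalgebra.comul (R := K) l)) ∈ A := by
    intro l
    rw [hA]
    apply TensorProduct.ext'
    intro a b
    simp only [LinearMap.comp_apply, LinearMap.mul'_apply, hXU, hX3]
    generalize (Coalgebra.comul (R := K) l) = c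
    induction c with
    | zero => simp
    | add a b ha hb => simp only [map_add, ha, hb, LinearMap.add_apply]
    | tmul a b => simp [hρ, hXU]
  clear_value A
  let π : A →ₐ[K] U := (AlgHom.fst K U (U ⊗[K] U)).comp A.val
  have hπ : Function.Bijective π := by
    constructor
    · rintro ⟨⟨u, t⟩, h⟩ ⟨⟨u', t'⟩, h'⟩ h0
      have h0' : u = u' := h0
      subst h0'
      have g := (hA _).1 h
      have g' := (hA _).1 h'
      simp only at g g'
      let G : U ⊗[K] U →ₗ[K] (T ⊗[K] T →ₗ[K] T) :=
        (LinearMap.llcomp K (T ⊗[K] T) (T ⊗[K] T) T (LinearMap.mul' K T)) ∘ₗ ρ.toLinearMap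
      have hG : Function.Injective G := aux_ker G hρinj
      have : t = t' := hG (g.trans g'.symm)
      subst this
      rfl
    · apply ind
      · intro l
        exact ⟨⟨_, hXA l⟩, rfl⟩
      · intro r
        exact ⟨algebraMap K A r, AlgHom.commutes _ _⟩
      · rintro _ _ ⟨a, rfl⟩ ⟨b, rfl⟩
        exact ⟨a + b, map_add _ _ _⟩
      · rintro _ _ ⟨a, rfl⟩ ⟨b, rfl⟩
        exact ⟨a * b, map_mul _ _ _⟩
  let Δ : U →ₐ[K] U ⊗[K] U := ((AlgHom.snd K U (U ⊗[K] U)).comp A.val).comp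
    (AlgEquiv.ofBijective π hπ).symm.toAlgHom
  have hΔ : ∀ l, Δ (XU l) = TensorProduct.map XU XU (Coalgebra.comul (R := K) l) := by
    intro l
    have : (AlgEquiv.ofBijective π hπ).symm (XU l) = ⟨_, hXA l⟩ := by
      rw [AlgEquiv.symm_apply_eq]; rfl
    change ((AlgEquiv.ofBijective π hπ).symm (XU l)).1.2 = _
    rw [this]
  have h1 : ∀ u : U, u.1 (1 : T) = E (u.1 1) • (1 : T) := by
    apply ind
    · intro l; rw [hXU, hX1]; simp
    · intro r; simp [Algebra.algebraMap_eq_smul_one]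
    · intro a b ha hb
      simp only [Subalgebra.coe_add, LinearMap.add_apply, map_add, add_smul, ← ha, ← hb]
    · intro a b ha hb
      simp only [Subalgebra.coe_mul, Module.End.mul_apply]
      rw [hb, map_smul, ha]
      simp [smul_smul]
  let e : U →ₐ[K] K := AlgHom.ofLinearMap (LinearMap.applyₗ (1 : T) ∘ₗ j) (by simp [j]) (by
    intro a b
    change E (a.1 (b.1 1)) = E (a.1 1) * E (b.1 1)
    rw [h1 b, map_smul]
    simp [mul_comm])
  have he : ∀ l, e (XU l) = Coalgebra.counit (R := K) l := by
    intro l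
    change E ((XU l).1 1) = _
    rw [hXU, hX1]; simp
  refine ⟨⟨(Δ, e), ⟨hΔ, he⟩, ?_⟩, ?_⟩
  · rintro ⟨q1, q2⟩ ⟨hq1, hq2⟩
    refine Prod.ext ?_ ?_
    · apply AlgHom.ext_of_adjoin_eq_top hgen
      rintro _ ⟨l, rfl⟩
      exact (hq1 l).trans (hΔ l).symm
    · apply AlgHom.ext_of_adjoin_eq_top hgen
      rintro _ ⟨l, rfl⟩
      exact (hq2 l).trans (he l).symm
  · rintro ⟨p, q⟩ ⟨hp, hq⟩
    simp only at hp hq ⊢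
    have hpc : p.toLinearMap ∘ₗ XU = TensorProduct.map XU XU ∘ₗ Coalgebra.comul (R := K) :=
      LinearMap.ext hp
    have hqc : q.toLinearMap ∘ₗ XU = Coalgebra.counit (R := K) := LinearMap.ext hq
    refine ⟨?_, ?_, ?_⟩
    · have : ((Algebra.TensorProduct.assoc K K K U U U).toAlgHom.comp
          (Algebra.TensorProduct.map p (AlgHom.id K U))).comp p =
          (Algebra.TensorProduct.map (AlgHom.id K U) p).comp p := by
        apply AlgHom.ext_of_adjoin_eq_top hgen
        rintro _ ⟨l, rfl⟩
        have h := congrArg (TensorProduct.map XU (TensorProduct.map XU XU))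
          (Coalgebra.coassoc_apply (R := K) l)
        simp only [AlgHom.comp_apply, hp]
        refine Eq.trans ?_ (h.trans ?_)
        · generalize (Coalgebra.comul (R := K) l) = c
          induction c with
          | zero => simp
          | add a b ha hb => simp only [map_add, ha, hb]
          | tmul a b =>
            simp only [TensorProduct.map_tmul, Algebra.TensorProduct.map_tmul, hp,
              LinearMap.rTensor_tmul, AlgHom.id_apply]
            generalize (Coalgebra.comul (R := K) a) = c
            induction c with
            | zero => simp
            | add a b ha hb => simp only [map_add, TensorProduct.add_tmul, ha, hb]
            | tmul a b => simp
        · generalize (Coalgebra.comul (R := K) l) = c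
          induction c with
          | zero => simp
          | add a b ha hb => simp only [map_add, ha, hb]
          | tmul a b => simp [hp]
      ext1 u
      exact AlgHom.congr_fun this u
    · have : ((Algebra.TensorProduct.lid K U).toAlgHom.comp
          (Algebra.TensorProduct.map q (AlgHom.id K U))).comp p = AlgHom.id K U := by
        apply AlgHom.ext_of_adjoin_eq_top hgen
        rintro _ ⟨l, rfl⟩
        have h := congrArg (fun z => XU (TensorProduct.lid K L z))
          (Coalgebra.rTensor_counit_comul (R := K) l)
        simp only [TensorProduct.lid_tmul, one_smul] at h
        simp only [AlgHom.comp_apply, hp, AlgHom.id_apply]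
        refine Eq.trans ?_ h
        generalize (Coalgebra.comul (R := K) l) = c
        induction c with
        | zero => simp
        | add a b ha hb => simp only [map_add, ha, hb]
        | tmul a b => simp [hq]
      ext1 u
      exact AlgHom.congr_fun this u
    · have : ((Algebra.TensorProduct.rid K K U).toAlgHom.comp
          (Algebra.TensorProduct.map (AlgHom.id K U) q)).comp p = AlgHom.id K U := by
        apply AlgHom.ext_of_adjoin_eq_top hgen
        rintro _ ⟨l, rfl⟩
        have h := congrArg (fun z => XU (TensorProduct.rid K L z))
          (Coalgebra.lTensor_counit_comul (R := K) l)
        simp only [TensorProduct.rid_tmul, one_smul] at h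
        simp only [AlgHom.comp_apply, hp, AlgHom.id_apply]
        refine Eq.trans ?_ h
        generalize (Coalgebra.comul (R := K) l) = c
        induction c with
        | zero => simp
        | add a b ha hb => simp only [map_add, ha, hb]
        | tmul a b => simp [hq]
      ext1 u
      exact AlgHom.congr_fun this u
end

section
/- Let K be a field and A a bialgebra over K with coproduct Δ, counit ε, multiplication m, and flip map τ : A ⊗ A → A ⊗ A. Let I be a two-sided ideal of A which is a coideal (Δ(I) ⊆ I ⊗ A + A ⊗ I), and let S : A → A be a linear map with S(1) = 1 and S(ab) = S(b)S(a) for all a, b ∈ A, such that for every a ∈ A: Δ(S(a)) − (S ⊗ S)(τ(Δ(a))) ∈ I ⊗ A + A ⊗ I. Suppose R₀ ⊆ A is a subspace with Δ(R₀) ⊆ R₀ ⊗ A + A ⊗ R₀ such that I is the two-sided ideal generated by R₀. Let J be the two-sided ideal of A generated by ⋃_{n ≥ 0} Sⁿ(R₀). Then: (1) I ⊆ J; (2) S(J) ⊆ J; (3) Δ(J) ⊆ J ⊗ A + A ⊗ J; and (4) J is minimal with these properties: J is contained in every two-sided ideal J' of A satisfying I ⊆ J' and S(J') ⊆ J'.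 -/
open TensorProduct

/-- `P ⊗ A + A ⊗ P`. -/
def coidealSpan (K A : Type) [Field K] [Ring A] [Bialgebra K A] (P : Submodule K A) :
    Submodule K (A ⊗[K] A) :=
  LinearMap.range (TensorProduct.map P.subtype (LinearMap.id : A →ₗ[K] A)) ⊔
      LinearMap.range (TensorProduct.map (LinearMap.id : A →ₗ[K] A) P.subtype)

section helpers

variable {K A : Type} [Field K] [Ring A] [Bialgebra K A] {P : Submodule K A}

lemma left_mem_coidealSpan {x : A} (hx : x ∈ P) (a : A) :
    x ⊗ₜ[K] a ∈ coidealSpan K A P :=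
  Submodule.mem_sup_left ⟨(⟨x, hx⟩ : P) ⊗ₜ[K] a, by simp⟩

lemma right_mem_coidealSpan {x : A} (hx : x ∈ P) (a : A) :
    a ⊗ₜ[K] x ∈ coidealSpan K A P :=
  Submodule.mem_sup_right ⟨a ⊗ₜ[K] (⟨x, hx⟩ : P), by simp⟩

lemma coidealSpan_le {Q : Submodule K (A ⊗[K] A)}
    (h1 : ∀ x ∈ P, ∀ a : A, x ⊗ₜ[K] a ∈ Q) (h2 : ∀ x ∈ P, ∀ a : A, a ⊗ₜ[K] x ∈ Q) :
    coidealSpan K A P ≤ Q := by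
  refine sup_le ?_ ?_
  · rintro _ ⟨t, rfl⟩
    induction t with
    | zero => simp
    | tmul x y => simpa using h1 x x.2 y
    | add x y hx hy => rw [map_add]; exact Q.add_mem hx hy
  · rintro _ ⟨t, rfl⟩
    induction t with
    | zero => simp
    | tmul x y => simpa using h2 y y.2 x
    | add x y hx hy => rw [map_add]; exact Q.add_mem hx hy

lemma coidealSpan_mul_left (hP : ∀ x ∈ P, ∀ a : A, a * x ∈ P ∧ x * a ∈ P)
    (s : A ⊗[K] A) {t : A ⊗[K] A} (ht : t ∈ coidealSpan K A P) :
    s * t ∈ coidealSpan K A P := by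
  induction s with
  | zero => simp
  | add x y hx hy => rw [add_mul]; exact Submodule.add_mem _ hx hy
  | tmul u v =>
    have : coidealSpan K A P ≤
        (coidealSpan K A P).comap (LinearMap.mulLeft K (u ⊗ₜ[K] v)) := by
      refine coidealSpan_le ?_ ?_
      · intro x hx a
        simpa using left_mem_coidealSpan (hP x hx u).1 (v * a)
      · intro x hx a
        simpa using right_mem_coidealSpan (hP x hx v).1 (u * a)
    exact this ht

lemma coidealSpan_mul_right (hP : ∀ x ∈ P, ∀ a : A, a * x ∈ P ∧ x * a ∈ P)
    (s : A ⊗[K] A) {t : A ⊗[K] A} (ht : t ∈ coidealSpan K A P) :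
    t * s ∈ coidealSpan K A P := by
  induction s with
  | zero => simp
  | add x y hx hy => rw [mul_add]; exact Submodule.add_mem _ hx hy
  | tmul u v =>
    have : coidealSpan K A P ≤
        (coidealSpan K A P).comap (LinearMap.mulRight K (u ⊗ₜ[K] v)) := by
      refine coidealSpan_le ?_ ?_
      · intro x hx a
        simpa using left_mem_coidealSpan (hP x hx u).2 (a * v)
      · intro x hx a
        simpa using right_mem_coidealSpan (hP x hx v).2 (a * u)
    exact this ht

lemma coidealSpan_map (S : Module.End K A) (hP : ∀ x ∈ P, S x ∈ P)
    {t : A ⊗[K] A} (ht : t ∈ coidealSpan K A P) :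
    TensorProduct.map S S ((TensorProduct.comm K A A) t) ∈ coidealSpan K A P := by
  have : coidealSpan K A P ≤ (coidealSpan K A P).comap
      (TensorProduct.map S S ∘ₗ (TensorProduct.comm K A A).toLinearMap) := by
    refine coidealSpan_le ?_ ?_
    · intro x hx a
      simpa using right_mem_coidealSpan (hP x hx) (S a)
    · intro x hx a
      simpa using left_mem_coidealSpan (hP x hx) (S a)
  exact this ht

end helpers

theorem stmt_16 (K A : Type) [Field K] [Ring A] [Bialgebra K A]
    (S : Module.End K A) (hS1 : S 1 = 1)
    (hSanti : ∀ a b : A, S (a * b) = S b * S a)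
    (I : Submodule K A)
    (hI_ideal : ∀ x ∈ I, ∀ a : A, a * x ∈ I ∧ x * a ∈ I)
    (hI_coideal : ∀ x ∈ I, Coalgebra.comul (R := K) x ∈
      LinearMap.range (TensorProduct.map I.subtype (LinearMap.id : A →ₗ[K] A)) ⊔
      LinearMap.range (TensorProduct.map (LinearMap.id : A →ₗ[K] A) I.subtype))
    (hS_comul : ∀ a : A,
      Coalgebra.comul (R := K) (S a) -
        TensorProduct.map S S ((TensorProduct.comm K A A) (Coalgebra.comul (R := K) a)) ∈
      LinearMap.range (TensorProduct.map I.subtype (LinearMap.id : A →ₗ[K] A)) ⊔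
      LinearMap.range (TensorProduct.map (LinearMap.id : A →ₗ[K] A) I.subtype))
    (R₀ : Submodule K A)
    (hR₀ : ∀ r ∈ R₀, Coalgebra.comul (R := K) r ∈
      LinearMap.range (TensorProduct.map R₀.subtype (LinearMap.id : A →ₗ[K] A)) ⊔
      LinearMap.range (TensorProduct.map (LinearMap.id : A →ₗ[K] A) R₀.subtype))
    -- `I` is the two-sided ideal generated by `R₀`
    (hIR₀ : I = Submodule.span K {y : A | ∃ a b : A, ∃ r ∈ R₀, y = a * r * b})
    -- `J` is the two-sided ideal generated by `⋃ n, Sⁿ(R₀)`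
    (J : Submodule K A)
    (hJ : J = Submodule.span K {y : A |
      ∃ a b r : A, (∃ n : ℕ, ∃ r₀ ∈ R₀, r = (S ^ n) r₀) ∧ y = a * r * b}) :
    I ≤ J ∧
    (∀ x ∈ J, S x ∈ J) ∧
    (∀ x ∈ J, Coalgebra.comul (R := K) x ∈
      LinearMap.range (TensorProduct.map J.subtype (LinearMap.id : A →ₗ[K] A)) ⊔
      LinearMap.range (TensorProduct.map (LinearMap.id : A →ₗ[K] A) J.subtype)) ∧
    (∀ J' : Submodule K A, (∀ x ∈ J', ∀ a : A, a * x ∈ J' ∧ x * a ∈ J') →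
      I ≤ J' → (∀ x ∈ J', S x ∈ J') → J ≤ J') := by
  have hgen : ∀ (n : ℕ), ∀ r ∈ R₀, ∀ a b : A, a * (S ^ n) r * b ∈ J := by
    intro n r hr a b
    rw [hJ]
    exact Submodule.subset_span ⟨a, b, _, ⟨n, r, hr, rfl⟩, rfl⟩
  have hle : ∀ Q : Submodule K A,
      (∀ (n : ℕ), ∀ r ∈ R₀, ∀ a b : A, a * (S ^ n) r * b ∈ Q) → J ≤ Q := by
    intro Q hQ
    rw [hJ, Submodule.span_le]
    rintro _ ⟨a, b, _, ⟨n, r, hr, rfl⟩, rfl⟩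
    exact hQ n r hr a b
  have hRI : ∀ r ∈ R₀, r ∈ I := by
    intro r hr
    rw [hIR₀]
    exact Submodule.subset_span ⟨1, 1, r, hr, by simp⟩
  have hIJ : I ≤ J := by
    rw [hIR₀, Submodule.span_le]
    rintro _ ⟨a, b, r, hr, rfl⟩
    simpa using hgen 0 r hr a b
  have hSJ : ∀ x ∈ J, S x ∈ J := by
    have : J ≤ J.comap S := by
      refine hle _ ?_
      intro n r hr a b
      rw [Submodule.mem_comap, hSanti, hSanti, ← mul_assoc]
      have := hgen (n + 1) r hr (S b) (S a)
      rwa [pow_succ', Module.End.mul_apply] at this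
    exact this
  have hJid : ∀ x ∈ J, ∀ a : A, a * x ∈ J ∧ x * a ∈ J := by
    intro x hx c
    constructor
    · have : J ≤ J.comap (LinearMap.mulLeft K c) := by
        refine hle _ ?_
        intro n r hr a b
        simpa [mul_assoc] using hgen n r hr (c * a) b
      exact this hx
    · have : J ≤ J.comap (LinearMap.mulRight K c) := by
        refine hle _ ?_
        intro n r hr a b
        simpa [mul_assoc] using hgen n r hr a (b * c)
      exact this hx
  have hmono : coidealSpan K A I ≤ coidealSpan K A J :=
    coidealSpan_le (fun x hx a => left_mem_coidealSpan (hIJ hx) a)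
      (fun x hx a => right_mem_coidealSpan (hIJ hx) a)
  have hpow : ∀ (n : ℕ), ∀ r ∈ R₀,
      Coalgebra.comul (R := K) ((S ^ n) r) ∈ coidealSpan K A J := by
    intro n r hr
    induction n with
    | zero => exact hmono (hI_coideal _ (by simpa using hRI r hr))
    | succ n ih =>
      rw [pow_succ', Module.End.mul_apply]
      have h1 := hmono (hS_comul ((S ^ n) r))
      have h2 := Submodule.add_mem _ h1 (coidealSpan_map S hSJ ih)
      rwa [sub_add_cancel] at h2
  refine ⟨hIJ, hSJ, ?_, ?_⟩
  · have : J ≤ (coidealSpan K A J).comap (Coalgebra.comul (R := K) (A := A)) := by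
      refine hle _ ?_
      intro n r hr a b
      rw [Submodule.mem_comap, Bialgebra.comul_mul, Bialgebra.comul_mul]
      exact coidealSpan_mul_right hJid _ (coidealSpan_mul_left hJid _ (hpow n r hr))
    exact this
  · intro J' hid hI' hS'
    refine hle _ ?_
    intro n r hr a b
    have : (S ^ n) r ∈ J' := by
      induction n with
      | zero => simpa using hI' (hRI r hr)
      | succ n ih => rw [pow_succ', Module.End.mul_apply]; exact hS' _ ih
    exact (hid _ (hid _ this a).1 b).2
end
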